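/- arXiv:1407.5128 — 3 statements merged into one kernel-verified Lean document; each statement's English description precedes it below -/
import Mathlib

section
/- Let k ≥ 2, let G be a finite simple graph, and let G' be the 3-colorability graph constructed from G and k. Then G is k-colorable if and only if G' is 3-colorable. -/
/-- Vertices of the 3-colorability graph `G'` built from a finite simple graph `G` on
`Fin n` and `k`:
* palette vertices `T`, `F`, `R`;
* selector vertices `sel v j` (the pair `(v, j)`) for `v : Fin n`, `j : Fin k`;
* for each `v`, the fresh internal vertices of the copy of `CHAIN k` attached to `v`:
  `chAB v j 0 = a_j`, `chAB v j 1 = b_j` for `j : Fin (k-1)`, and the non-final outputs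
  `chY v j = y_j` for `j : Fin (k-2)` (the final output `y_{k-2}` is identified with `T`);
* for each `v` and pair `j₁ < j₂` in `Fin k`, fresh internal vertices `a = pAB … 0`,
  `b = pAB … 1` of a copy of `GAD`;
* for each edge `{u,v}` of `G` (recorded with `u < v`) and each `j : Fin k`, fresh
  internal vertices `a = eAB … 0`, `b = eAB … 1` of a copy of `GAD`. -/
inductive GVert (n k : ℕ) (G : SimpleGraph (Fin n)) : Type where
  | T : GVert n k G
  | F : GVert n k G
  | R : GVert n k G
  | sel (v : Fin n) (j : Fin k) : GVert n k G
  | chAB (v : Fin n) (j : Fin (k - 1)) (i : Fin 2) : GVert n k G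
  | chY (v : Fin n) (j : Fin (k - 2)) : GVert n k G
  | pAB (v : Fin n) (j₁ j₂ : Fin k) (h : j₁ < j₂) (i : Fin 2) : GVert n k G
  | eAB (u v : Fin n) (h : u < v) (hadj : G.Adj u v) (j : Fin k) (i : Fin 2) : GVert n k G

/-- The output `y_j` of the `j`-th gadget of the copy of `CHAIN k` attached to `v`;
the final output `y_{k-2}` is identified with the palette vertex `T`. -/
def chainOut (n k : ℕ) (G : SimpleGraph (Fin n)) (v : Fin n) (j : Fin (k - 1)) :
    GVert n k G :=
  if _ : j.1 = k - 2 then .T else .chY v ⟨j.1, by have := j.2; omega⟩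

/-- The input of the `j`-th gadget of the copy of `CHAIN k` attached to `v`:
`in_0 = x_0 = (v, 0)` and `in_j = y_{j-1}` for `j ≥ 1`. -/
def chainIn (n k : ℕ) (G : SimpleGraph (Fin n)) (v : Fin n) (j : Fin (k - 1)) :
    GVert n k G :=
  if _ : j.1 = 0 then .sel v ⟨0, by have := j.2; omega⟩
  else .chY v ⟨j.1 - 1, by have := j.2; omega⟩

/-- The 3-colorability graph `G'` built from `G` and `k`:
(1) the palette triangle on `T, F, R`; (2) each selector vertex `(v, j)` joined to `R`;
(3) for each `v`, a copy of `CHAIN k` with inputs `(v, 0), …, (v, k-1)` and output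
identified with `T`; (4) for each `v` and `j₁ < j₂`, a copy of `GAD` with
`x = (v, j₁)`, `y = (v, j₂)`, `z = F`; (5) for each edge `{u, v}` of `G` and each `j`,
a copy of `GAD` with `x = (u, j)`, `y = (v, j)`, `z = F`. -/
def GPrime (n k : ℕ) (G : SimpleGraph (Fin n)) : SimpleGraph (GVert n k G) :=
  SimpleGraph.fromEdgeSet (
    {s(GVert.T, GVert.F), s(GVert.T, GVert.R), s(GVert.F, GVert.R)}
    ∪ (⋃ v : Fin n, ⋃ j : Fin k, {s(GVert.sel v j, GVert.R)})
    ∪ (⋃ v : Fin n, ⋃ j : Fin (k - 1),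
        {s(chainIn n k G v j, GVert.chAB v j 0),
         s(GVert.sel v ⟨j.1 + 1, by have := j.2; omega⟩, GVert.chAB v j 1),
         s(GVert.chAB v j 0, GVert.chAB v j 1),
         s(GVert.chAB v j 0, chainOut n k G v j),
         s(GVert.chAB v j 1, chainOut n k G v j)})
    ∪ (⋃ v : Fin n, ⋃ p : {p : Fin k × Fin k // p.1 < p.2},
        {s(GVert.sel v p.1.1, GVert.pAB v p.1.1 p.1.2 p.2 0),
         s(GVert.sel v p.1.2, GVert.pAB v p.1.1 p.1.2 p.2 1),
         s(GVert.pAB v p.1.1 p.1.2 p.2 0, GVert.pAB v p.1.1 p.1.2 p.2 1),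
         s(GVert.pAB v p.1.1 p.1.2 p.2 0, GVert.F),
         s(GVert.pAB v p.1.1 p.1.2 p.2 1, GVert.F)})
    ∪ (⋃ e : {p : Fin n × Fin n // p.1 < p.2 ∧ G.Adj p.1 p.2}, ⋃ j : Fin k,
        {s(GVert.sel e.1.1 j, GVert.eAB e.1.1 e.1.2 e.2.1 e.2.2 j 0),
         s(GVert.sel e.1.2 j, GVert.eAB e.1.1 e.1.2 e.2.1 e.2.2 j 1),
         s(GVert.eAB e.1.1 e.1.2 e.2.1 e.2.2 j 0, GVert.eAB e.1.1 e.1.2 e.2.1 e.2.2 j 1),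
         s(GVert.eAB e.1.1 e.1.2 e.2.1 e.2.2 j 0, GVert.F),
         s(GVert.eAB e.1.1 e.1.2 e.2.1 e.2.2 j 1, GVert.F)}))

theorem gad_force : ∀ x y a b z : Fin 3, x ≠ a → y ≠ b → a ≠ b → a ≠ z → b ≠ z → x = y → z = x := by
  decide

theorem gad_exists : ∀ x y z : Fin 3, ∃ a b : Fin 3, (x = y → z = x) →
    x ≠ a ∧ y ≠ b ∧ a ≠ b ∧ a ≠ z ∧ b ≠ z := by
  decide

theorem third_color : ∀ t f r s : Fin 3, t ≠ f → t ≠ r → f ≠ r → s ≠ r → s ≠ t → s = f := by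
  intros; omega

theorem gprime_valid (n k : ℕ) (G : SimpleGraph (Fin n)) (C : GVert n k G → Fin 3)
    (h1 : C .T ≠ C .F ∧ C .T ≠ C .R ∧ C .F ≠ C .R)
    (h2 : ∀ v j, C (.sel v j) ≠ C .R)
    (h3 : ∀ v (j : Fin (k-1)), C (chainIn n k G v j) ≠ C (.chAB v j 0) ∧
      C (.sel v ⟨j.1 + 1, by have := j.2; omega⟩) ≠ C (.chAB v j 1) ∧
      C (.chAB v j 0) ≠ C (.chAB v j 1) ∧ C (.chAB v j 0) ≠ C (chainOut n k G v j) ∧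
      C (.chAB v j 1) ≠ C (chainOut n k G v j))
    (h4 : ∀ v (j₁ j₂ : Fin k) (h : j₁ < j₂), C (.sel v j₁) ≠ C (.pAB v j₁ j₂ h 0) ∧
      C (.sel v j₂) ≠ C (.pAB v j₁ j₂ h 1) ∧ C (.pAB v j₁ j₂ h 0) ≠ C (.pAB v j₁ j₂ h 1) ∧
      C (.pAB v j₁ j₂ h 0) ≠ C .F ∧ C (.pAB v j₁ j₂ h 1) ≠ C .F)
    (h5 : ∀ u v (h : u < v) (ha : G.Adj u v) (j : Fin k), C (.sel u j) ≠ C (.eAB u v h ha j 0) ∧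
      C (.sel v j) ≠ C (.eAB u v h ha j 1) ∧ C (.eAB u v h ha j 0) ≠ C (.eAB u v h ha j 1) ∧
      C (.eAB u v h ha j 0) ≠ C .F ∧ C (.eAB u v h ha j 1) ≠ C .F) :
    (GPrime n k G).Colorable 3 := by
  refine ⟨SimpleGraph.Coloring.mk C ?_⟩
  have key : ∀ p q x y : GVert n k G, s(x, y) = s(p, q) → C p ≠ C q → C x ≠ C y := by
    intro p q x y h hn
    rcases Sym2.eq_iff.1 h with ⟨rfl, rfl⟩ | ⟨rfl, rfl⟩
    · exact hn
    · exact hn.symm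
  intro x y hxy
  rw [GPrime, SimpleGraph.fromEdgeSet_adj] at hxy
  obtain ⟨hxy, -⟩ := hxy
  simp only [Set.mem_union, Set.mem_iUnion, Set.mem_insert_iff, Set.mem_singleton_iff] at hxy
  rcases hxy with (((h | ⟨v, j, h⟩) | ⟨v, j, h⟩) | ⟨v, p, h⟩) | ⟨e, j, h⟩
  · obtain ⟨a, b, c⟩ := h1
    rcases h with h | h | h <;> exact key _ _ _ _ h (by assumption)
  · exact key _ _ _ _ h (h2 v j)
  · obtain ⟨a, b, c, d, e⟩ := h3 v j
    rcases h with h | h | h | h | h <;> exact key _ _ _ _ h (by assumption)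
  · obtain ⟨a, b, c, d, e⟩ := h4 v p.1.1 p.1.2 p.2
    rcases h with h | h | h | h | h <;> exact key _ _ _ _ h (by assumption)
  · obtain ⟨a, b, c, d, f⟩ := h5 e.1.1 e.1.2 e.2.1 e.2.2 j
    rcases h with h | h | h | h | h <;> exact key _ _ _ _ h (by assumption)

theorem gprime_mem (n k : ℕ) (G : SimpleGraph (Fin n)) (C : (GPrime n k G).Coloring (Fin 3)) :
    (C .T ≠ C .F ∧ C .T ≠ C .R ∧ C .F ≠ C .R) ∧
    (∀ v j, C (.sel v j) ≠ C .R) ∧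
    (∀ v (j : Fin (k-1)), C (chainIn n k G v j) = C (.sel v ⟨j.1 + 1, by have := j.2; omega⟩) →
      C (chainOut n k G v j) = C (chainIn n k G v j)) ∧
    (∀ v (j₁ j₂ : Fin k), j₁ < j₂ → C (.sel v j₁) = C (.sel v j₂) → C .F = C (.sel v j₁)) ∧
    (∀ u v (j : Fin k), u < v → G.Adj u v → C (.sel u j) = C (.sel v j) → C .F = C (.sel u j)) := by
  refine ⟨⟨?_, ?_, ?_⟩, ?_, ?_, ?_, ?_⟩
  · apply C.valid; rw [GPrime, SimpleGraph.fromEdgeSet_adj]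
    exact ⟨Or.inl (Or.inl (Or.inl (Or.inl (Or.inl rfl)))), by simp⟩
  · apply C.valid; rw [GPrime, SimpleGraph.fromEdgeSet_adj]
    exact ⟨Or.inl (Or.inl (Or.inl (Or.inl (Or.inr (Or.inl rfl))))), by simp⟩
  · apply C.valid; rw [GPrime, SimpleGraph.fromEdgeSet_adj]
    exact ⟨Or.inl (Or.inl (Or.inl (Or.inl (Or.inr (Or.inr rfl))))), by simp⟩
  · intro v j; apply C.valid; rw [GPrime, SimpleGraph.fromEdgeSet_adj]
    refine ⟨Or.inl (Or.inl (Or.inl (Or.inr ?_))), by simp⟩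
    simp only [Set.mem_iUnion]; exact ⟨v, j, rfl⟩
  · intro v j
    have hin : ∀ i, chainIn n k G v j ≠ .chAB v j i := by
      intro i; unfold chainIn; split <;> simp
    have hout : ∀ i, .chAB v j i ≠ chainOut n k G v j := by
      intro i; unfold chainOut; split <;> simp
    apply gad_force _ _ (C (.chAB v j 0)) (C (.chAB v j 1)) <;>
    · apply C.valid; rw [GPrime, SimpleGraph.fromEdgeSet_adj]
      refine ⟨Or.inl (Or.inl (Or.inr ?_)), by first | exact hin _ | exact hout _ | simp⟩
      simp only [Set.mem_iUnion]; exact ⟨v, j, by first | exact Or.inl rfl | exact Or.inr (Or.inl rfl) | exact Or.inr (Or.inr (Or.inl rfl)) | exact Or.inr (Or.inr (Or.inr (Or.inl rfl))) | exact Or.inr (Or.inr (Or.inr (Or.inr rfl)))⟩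
  · intro v j₁ j₂ h
    apply gad_force _ _ (C (.pAB v j₁ j₂ h 0)) (C (.pAB v j₁ j₂ h 1)) <;>
    · apply C.valid; rw [GPrime, SimpleGraph.fromEdgeSet_adj]
      refine ⟨Or.inl (Or.inr ?_), by simp⟩
      simp only [Set.mem_iUnion]; exact ⟨v, ⟨(j₁, j₂), h⟩, by first | exact Or.inl rfl | exact Or.inr (Or.inl rfl) | exact Or.inr (Or.inr (Or.inl rfl)) | exact Or.inr (Or.inr (Or.inr (Or.inl rfl))) | exact Or.inr (Or.inr (Or.inr (Or.inr rfl)))⟩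
  · intro u v j h ha
    apply gad_force _ _ (C (.eAB u v h ha j 0)) (C (.eAB u v h ha j 1)) <;>
    · apply C.valid; rw [GPrime, SimpleGraph.fromEdgeSet_adj]
      refine ⟨Or.inr ?_, by simp⟩
      simp only [Set.mem_iUnion]; exact ⟨⟨(u, v), h, ha⟩, j, by first | exact Or.inl rfl | exact Or.inr (Or.inl rfl) | exact Or.inr (Or.inr (Or.inl rfl)) | exact Or.inr (Or.inr (Or.inr (Or.inl rfl))) | exact Or.inr (Or.inr (Or.inr (Or.inr rfl)))⟩

/-- For `k ≥ 2`, a finite simple graph `G` is `k`-colorable iff the 3-colorability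
graph `G'` constructed from `G` and `k` is 3-colorable. -/
theorem colorable_iff_gprime_colorable (n k : ℕ) (hk : 2 ≤ k) (G : SimpleGraph (Fin n)) :
    G.Colorable k ↔ (GPrime n k G).Colorable 3 := by
  constructor
  · rintro ⟨c⟩
    choose A B hAB using gad_exists
    let g : Fin 3 → Fin 3 → Fin 3 → Fin 2 → Fin 3 := fun x y z i => if i = 0 then A x y z else B x y z
    let s : Fin n → ℕ → Fin 3 := fun v j => if (c v).1 = j then 1 else 0
    let t : Fin n → ℕ → Fin 3 := fun v j => if (c v).1 ≤ j then 1 else 0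
    let C : GVert n k G → Fin 3 := fun w => match w with
      | .T => 1
      | .F => 0
      | .R => 2
      | .sel v j => s v j.1
      | .chAB v j i => g (t v j.1) (s v (j.1+1)) (t v (j.1+1)) i
      | .chY v j => t v (j.1+1)
      | .pAB v j₁ j₂ _ i => g (s v j₁.1) (s v j₂.1) 0 i
      | .eAB u v _ _ j i => g (s u j.1) (s v j.1) 0 i
    have hg : ∀ x y z, (x = y → z = x) → x ≠ g x y z 0 ∧ y ≠ g x y z 1 ∧
        g x y z 0 ≠ g x y z 1 ∧ g x y z 0 ≠ z ∧ g x y z 1 ≠ z := by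
      intro x y z h
      simpa [g] using hAB x y z h
    apply gprime_valid n k G C
    · have h : (1 : Fin 3) ≠ 0 ∧ (1 : Fin 3) ≠ 2 ∧ (0 : Fin 3) ≠ 2 := by decide
      exact h
    · intro v j
      change s v j.1 ≠ 2
      simp only [s]; split <;> decide
    · intro v j
      have hin : C (chainIn n k G v j) = t v j.1 := by
        unfold chainIn
        split
        · rename_i h
          simp [C, s, t, h]
        · rename_i h
          change t v (j.1 - 1 + 1) = _
          congr 1; omega
      have hout : C (chainOut n k G v j) = t v (j.1+1) := by
        unfold chainOut
        split
        · rename_i h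
          have h2 := (c v).2
          have : (c v).1 ≤ j.1 + 1 := by omega
          simp [C, t, this]
        · rfl
      rw [hin, hout]
      apply hg
      simp only [s, t]
      split_ifs <;> first | omega | simp
    · intro v j₁ j₂ h
      refine hg (s v j₁.1) (s v j₂.1) 0 ?_
      have : j₁.1 < j₂.1 := h
      simp only [s]
      split_ifs <;> first | omega | simp
    · intro u v h ha j
      refine hg (s u j.1) (s v j.1) 0 ?_
      have : (c u).1 ≠ (c v).1 := fun h => c.valid ha (Fin.ext h)
      simp only [s]
      split_ifs <;> first | omega | simp
  · rintro ⟨C⟩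
    obtain ⟨⟨h1, h2, h3⟩, hs, hc, hp, he⟩ := gprime_mem n k G C
    have ex : ∀ v, ∃ j, C (.sel v j) = C .T := by
      intro v
      by_contra! hne
      have hF : ∀ j, C (.sel v j) = C .F := fun j => third_color _ _ _ _ h1 h2 h3 (hs v j) (hne j)
      have hin : ∀ m (hm : m < k - 1), C (chainIn n k G v ⟨m, hm⟩) = C .F := by
        intro m
        induction m with
        | zero => intro hm; simp [chainIn, hF]
        | succ m ih =>
          intro hm
          have hm' : m < k - 1 := by omega
          have e : chainIn n k G v ⟨m+1, hm⟩ = chainOut n k G v ⟨m, hm'⟩ := by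
            have : m ≠ k - 2 := by omega
            simp [chainIn, chainOut, this]
          rw [e, hc v ⟨m, hm'⟩ (by rw [ih hm', hF]), ih hm']
      have hl : k - 2 < k - 1 := by omega
      have e : chainOut n k G v ⟨k-2, hl⟩ = .T := by simp [chainOut]
      have := hc v ⟨k-2, hl⟩ (by rw [hin, hF])
      rw [e, hin] at this
      exact h1 this
    choose f hf using ex
    have main : ∀ u v, u < v → G.Adj u v → f u ≠ f v := by
      intro u v h ha e
      have h4 := he u v (f u) h ha (by rw [hf u, e, hf v])
      exact h1 (by rw [h4, hf])
    refine ⟨SimpleGraph.Coloring.mk f ?_⟩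
    intro u v ha
    rcases lt_trichotomy u v with h | h | h
    · exact main u v h ha
    · exact absurd h ha.ne
    · exact (main v u h ha.symm).symm
end

section
/- Let k ≥ 2, let G be a finite simple graph, and let G' be the 3-colorability graph constructed from G and k. If G is k-colorable, then G' is 3-colorable. -/
/-- The explicit 3-coloring: `T = 0`, `F = 1`, `R = 2`. -/
def gcol (n k : ℕ) (G : SimpleGraph (Fin n)) (c : Fin n → Fin k) : GVert n k G → Fin 3
  | .T => 0
  | .F => 1
  | .R => 2
  | .sel v j => if (c v).1 = j.1 then 0 else 1
  | .chAB v j i =>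
      if (c v).1 ≤ j.1 then (if i = 0 then 1 else 2)
      else if (c v).1 = j.1 + 1 then (if i = 0 then 2 else 1)
      else (if i = 0 then 0 else 2)
  | .chY v j => if (c v).1 ≤ j.1 + 1 then 0 else 1
  | .pAB v j₁ _ _ i => if (c v).1 = j₁.1 then (if i = 0 then 2 else 0)
      else (if i = 0 then 0 else 2)
  | .eAB u _ _ _ j i => if (c u).1 = j.1 then (if i = 0 then 2 else 0)
      else (if i = 0 then 0 else 2)

theorem gcol_in (n k : ℕ) (G : SimpleGraph (Fin n)) (c : Fin n → Fin k) (v : Fin n)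
    (j : Fin (k - 1)) :
    gcol n k G c (chainIn n k G v j) = if (c v).1 ≤ j.1 then 0 else 1 := by
  unfold chainIn
  split_ifs <;> simp only [gcol] <;> (try split_ifs) <;> first | rfl | omega

theorem gcol_out (n k : ℕ) (G : SimpleGraph (Fin n)) (c : Fin n → Fin k) (v : Fin n)
    (j : Fin (k - 1)) :
    gcol n k G c (chainOut n k G v j) = if (c v).1 ≤ j.1 + 1 then 0 else 1 := by
  have := (c v).2
  unfold chainOut
  split_ifs <;> simp only [gcol] <;> (try split_ifs) <;> first | rfl | omega

theorem gcol_edge {n k : ℕ} {G : SimpleGraph (Fin n)} (f : GVert n k G → Fin 3)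
    {x y p q : GVert n k G} (h : s(x, y) = s(p, q)) (hpq : f p ≠ f q) : f x ≠ f y := by
  rcases Sym2.eq_iff.1 h with ⟨rfl, rfl⟩ | ⟨rfl, rfl⟩
  · exact hpq
  · exact hpq.symm

/-- For `k ≥ 2`, if a finite simple graph `G` is `k`-colorable, then the
3-colorability graph `G'` constructed from `G` and `k` is 3-colorable. -/
theorem gprime_colorable_of_colorable (n k : ℕ) (hk : 2 ≤ k) (G : SimpleGraph (Fin n))
    (h : G.Colorable k) : (GPrime n k G).Colorable 3 := by
  obtain ⟨c⟩ := h
  refine ⟨SimpleGraph.Coloring.mk (gcol n k G c) ?_⟩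
  intro x y hxy
  rw [GPrime, SimpleGraph.fromEdgeSet_adj] at hxy
  obtain ⟨hxy, -⟩ := hxy
  simp only [Set.mem_union, Set.mem_iUnion, Set.mem_insert_iff, Set.mem_singleton_iff] at hxy
  rcases hxy with (((h | ⟨v, j, h⟩) | ⟨v, j, h⟩) | ⟨v, ⟨⟨j₁, j₂⟩, hj⟩, h⟩) |
    ⟨⟨⟨u, v⟩, huv, hadj⟩, j, h⟩
  · rcases h with h | h | h <;> refine gcol_edge _ h ?_ <;> simp [gcol]
  · refine gcol_edge _ h ?_
    simp only [gcol]
    split_ifs <;> decide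
  · rcases h with h | h | h | h | h <;> refine gcol_edge _ h ?_ <;>
      (try simp only [gcol_in, gcol_out]) <;> simp only [gcol] <;> split_ifs <;>
      first | decide | omega
  · have hj' : j₁.1 < j₂.1 := hj
    rcases h with h | h | h | h | h <;> refine gcol_edge _ h ?_ <;>
      simp only [gcol] <;> split_ifs <;> first | decide | omega
  · have hc : (c u).1 ≠ (c v).1 := fun h => c.valid hadj (Fin.ext h)
    rcases h with h | h | h | h | h <;> refine gcol_edge _ h ?_ <;>
      simp only [gcol] <;> split_ifs <;> first | decide | omega
end

section
/- Let k ≥ 2, let G be a finite simple graph, and let G' be the 3-colorability graph constructed from G and k. If G' is 3-colorable, then G is k-colorable. -/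
theorem gad_aux (x y a b z : Fin 3) (h1 : x ≠ a) (h2 : y ≠ b) (h3 : a ≠ b) (h4 : a ≠ z)
    (h5 : b ≠ z) (h : x = y) : z = x := by
  omega

/-- For `k ≥ 2`, if the 3-colorability graph `G'` constructed from a finite simple
graph `G` and `k` is 3-colorable, then `G` is `k`-colorable. -/
theorem colorable_of_gprime_colorable (n k : ℕ) (hk : 2 ≤ k) (G : SimpleGraph (Fin n))
    (h : (GPrime n k G).Colorable 3) : G.Colorable k := by
  obtain ⟨c⟩ := h
  have pal : ∀ e ∈ ({s(GVert.T, GVert.F), s(GVert.T, GVert.R), s(GVert.F, GVert.R)} :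
      Set (Sym2 (GVert n k G))), ¬ e.IsDiag → e ∈ (GPrime n k G).edgeSet := by
    intro e he hd
    rw [GPrime, SimpleGraph.edgeSet_fromEdgeSet]
    exact ⟨Or.inl (Or.inl (Or.inl (Or.inl he))), hd⟩
  have hTF : c .T ≠ c .F := c.valid (pal s(_, _) (by simp) (by simp))
  have hTR : c .T ≠ c .R := c.valid (pal s(_, _) (by simp) (by simp))
  have hFR : c .F ≠ c .R := c.valid (pal s(_, _) (by simp) (by simp))
  have hs : ∀ v j, c (.sel v j) ≠ c .R := by
    intro v j
    have : s(GVert.sel v j, GVert.R) ∈ (GPrime n k G).edgeSet := by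
      rw [GPrime, SimpleGraph.edgeSet_fromEdgeSet]
      exact ⟨Or.inl (Or.inl (Or.inl (Or.inr
        (Set.mem_iUnion.2 ⟨v, Set.mem_iUnion.2 ⟨j, rfl⟩⟩)))), by simp⟩
    exact c.valid this
  have hTF' : ∀ v j, c (.sel v j) = c .T ∨ c (.sel v j) = c .F := by
    intro v j
    have := hs v j
    omega
  have key : ∀ v, ∃ j, c (.sel v j) = c .T := by
    intro v
    by_contra hno
    have hF : ∀ j, c (.sel v j) = c .F := fun j =>
      (hTF' v j).resolve_left (fun e => hno ⟨j, e⟩)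
    have step : ∀ j : Fin (k - 1), c (chainIn n k G v j) = c .F →
        c (chainOut n k G v j) = c .F := by
      intro j hj
      have adj : ∀ e ∈ ({s(chainIn n k G v j, GVert.chAB v j 0),
         s(GVert.sel v ⟨j.1 + 1, by have := j.2; omega⟩, GVert.chAB v j 1),
         s(GVert.chAB v j 0, GVert.chAB v j 1),
         s(GVert.chAB v j 0, chainOut n k G v j),
         s(GVert.chAB v j 1, chainOut n k G v j)} : Set (Sym2 (GVert n k G))),
         ¬ e.IsDiag → e ∈ (GPrime n k G).edgeSet := by
        intro e he hd
        rw [GPrime, SimpleGraph.edgeSet_fromEdgeSet]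
        refine ⟨Or.inl (Or.inl (Or.inr ?_)), hd⟩
        exact Set.mem_iUnion.2 ⟨v, Set.mem_iUnion.2 ⟨j, he⟩⟩
      have a1 : c (chainIn n k G v j) ≠ c (.chAB v j 0) :=
        c.valid (adj s(chainIn n k G v j, .chAB v j 0) (by simp)
          (by simp only [Sym2.mk_isDiag_iff, chainIn]; split <;> simp))
      have a2 : c (.sel v ⟨j.1 + 1, by have := j.2; omega⟩) ≠ c (.chAB v j 1) :=
        c.valid (adj s(_, _) (by simp) (by simp))
      have a3 : c (.chAB v j 0) ≠ c (.chAB v j 1) :=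
        c.valid (adj s(_, _) (by simp) (by simp))
      have a4 : c (.chAB v j 0) ≠ c (chainOut n k G v j) :=
        c.valid (adj s(.chAB v j 0, chainOut n k G v j) (by simp)
          (by simp only [Sym2.mk_isDiag_iff, chainOut]; split <;> simp))
      have a5 : c (.chAB v j 1) ≠ c (chainOut n k G v j) :=
        c.valid (adj s(.chAB v j 1, chainOut n k G v j) (by simp)
          (by simp only [Sym2.mk_isDiag_iff, chainOut]; split <;> simp))
      rw [gad_aux _ _ _ _ _ a1 a2 a3 a4 a5 (by rw [hj, hF]), hj]
    have all : ∀ m (hm : m < k - 1), c (chainOut n k G v ⟨m, hm⟩) = c .F := by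
      intro m
      induction m with
      | zero =>
        intro hm
        exact step _ (by simp [chainIn, hF])
      | succ m ih =>
        intro hm
        have := ih (by omega)
        apply step
        rw [chainOut, dif_neg (by simp; omega)] at this
        simpa [chainIn] using this
    have := all (k - 2) (by omega)
    simp [chainOut] at this
    exact hTF this
  choose f hf using key
  have main : ∀ u v, u < v → G.Adj u v → f u ≠ f v := by
    intro u v huv hadj hfe
    have adj : ∀ e ∈ ({s(GVert.sel u (f u), GVert.eAB u v huv hadj (f u) 0),
         s(GVert.sel v (f u), GVert.eAB u v huv hadj (f u) 1),
         s(GVert.eAB u v huv hadj (f u) 0, GVert.eAB u v huv hadj (f u) 1),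
         s(GVert.eAB u v huv hadj (f u) 0, GVert.F),
         s(GVert.eAB u v huv hadj (f u) 1, GVert.F)} : Set (Sym2 (GVert n k G))),
         ¬ e.IsDiag → e ∈ (GPrime n k G).edgeSet := by
      intro e he hd
      rw [GPrime, SimpleGraph.edgeSet_fromEdgeSet]
      refine ⟨Or.inr ?_, hd⟩
      exact Set.mem_iUnion.2 ⟨⟨(u, v), huv, hadj⟩, Set.mem_iUnion.2 ⟨f u, he⟩⟩
    have a1 : c (.sel u (f u)) ≠ c (.eAB u v huv hadj (f u) 0) :=
      c.valid (adj s(_, _) (by simp) (by simp))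
    have a2 : c (.sel v (f u)) ≠ c (.eAB u v huv hadj (f u) 1) :=
      c.valid (adj s(_, _) (by simp) (by simp))
    have a3 : c (.eAB u v huv hadj (f u) 0) ≠ c (.eAB u v huv hadj (f u) 1) :=
      c.valid (adj s(_, _) (by simp) (by simp))
    have a4 : c (.eAB u v huv hadj (f u) 0) ≠ c .F :=
      c.valid (adj s(_, _) (by simp) (by simp))
    have a5 : c (.eAB u v huv hadj (f u) 1) ≠ c .F :=
      c.valid (adj s(_, _) (by simp) (by simp))
    have hv := hf v
    rw [← hfe] at hv
    have := gad_aux _ _ _ _ _ a1 a2 a3 a4 a5 (by rw [hf, hv])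
    rw [hf] at this
    exact hTF this.symm
  refine ⟨SimpleGraph.Coloring.mk f ?_⟩
  intro u v huv
  rcases lt_or_gt_of_ne huv.ne with hl | hl
  · exact main u v hl huv
  · exact (main v u hl huv.symm).symm
end
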